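/- Let W be the weight function of the k_n-nearest neighbor classifier (w_i^S(x) = 1/k_n if x_i is one of the k_n nearest sample points to x, else 0), where lim_{n→∞} k_n/n = 0. Then for any data distribution D = (μ, η) over ℝ^d × {±1} and any 0 < p < 1, lim_{n→∞} E_{S∼D^n}[sup_{x∈ℝ^d} Σ_{i=1}^n w_i^S(x)·1{ρ(x, x_i) > r_p(x)}] = 0. -/

import Mathlib

open MeasureTheory Metric Set Filter Topology
open scoped ENNReal Classical

noncomputable section

/-- The real value of a `Bool` label: `true ↦ +1`, `false ↦ -1`. -/
def labelVal (b : Bool) : ℝ := if b then 1 else -1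

abbrev Eucl (d : ℕ) : Type := EuclideanSpace ℝ (Fin d)

section BasicDefs

variable {E : Type*} [MeasurableSpace E]

/-- The joint distribution on instance-label pairs determined by the marginal `μ`
and the regression function `η` (label `+1` with probability `η x`). -/
def jointD (μ : Measure E) (η : E → ℝ) : Measure (E × Bool) :=
  μ.bind fun x =>
    ENNReal.ofReal (η x) • Measure.dirac (x, true) +
      ENNReal.ofReal (1 - η x) • Measure.dirac (x, false)

/-- The distribution of an i.i.d. sample of size `n` from `D = (μ, η)`. -/
def sampleD (μ : Measure E) (η : E → ℝ) (n : ℕ) : Measure (Fin n → E × Bool) :=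
  Measure.pi fun _ => jointD μ η

/-- The accuracy `A(f, D) = P_{(x,y) ∼ D}[f x = y]`. -/
def accuracy (μ : Measure E) (η : E → ℝ) (f : E → Bool) : ℝ :=
  (jointD μ η {p | f p.1 = p.2}).toReal

/-- The astuteness `A_U(f, D) = P_{(x,y) ∼ D}[f x' = y for all x' ∈ U x]`. -/
def astuteness (μ : Measure E) (η : E → ℝ) (U : E → Set E) (f : E → Bool) : ℝ :=
  (jointD μ η {p | ∀ x' ∈ U p.1, f x' = p.2}).toReal

/-- The Bayes optimal classifier: `+1` iff `η x ≥ 1/2`. -/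
def bayes (η : E → ℝ) : E → Bool := fun x => if (1/2 : ℝ) ≤ η x then true else false

end BasicDefs

section MetricDefs

variable {E : Type*} [MetricSpace E]

/-- The neighborhood preserving Bayes optimal classifier:
`+1` at `x` iff `ρ(x, μ⁺) ≤ ρ(x, μ⁻)`. -/
def gNeighbor (η : E → ℝ) : E → Bool := fun x =>
  if infDist x {z | (1/2 : ℝ) < η z} ≤ infDist x {z | η z < (1/2 : ℝ)} then true else false

/-- The neighborhood preserving robustness region `V_x`. -/
def nbhdRegion (η : E → ℝ) (x : E) : Set E :=
  if (1/2 : ℝ) < η x then {x' | dist x x' < infDist x' {z | η z ≤ (1/2 : ℝ)}}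
  else if η x < (1/2 : ℝ) then {x' | dist x x' < infDist x' {z | (1/2 : ℝ) ≤ η z}}
  else {x}

/-- The partial neighborhood preserving robustness region `V_x^κ`. -/
def nbhdRegionK (η : E → ℝ) (κ : ℝ) (x : E) : Set E :=
  if (1/2 : ℝ) < η x then {x' | dist x x' < κ * infDist x' {z | η z ≤ (1/2 : ℝ)}}
  else if η x < (1/2 : ℝ) then {x' | dist x x' < κ * infDist x' {z | (1/2 : ℝ) ≤ η z}}
  else {x}

variable [MeasurableSpace E]

/-- The support of a measure: all points whose balls all have positive mass. -/
def msupport (μ : Measure E) : Set E := {x | ∀ r > 0, 0 < μ (Metric.ball x r)}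

/-- `D⁺`: points of the support where `η > 1/2`. -/
def Dplus (μ : Measure E) (η : E → ℝ) : Set E := {x | x ∈ msupport μ ∧ (1/2 : ℝ) < η x}

/-- `D⁻`: points of the support where `η < 1/2`. -/
def Dminus (μ : Measure E) (η : E → ℝ) : Set E := {x | x ∈ msupport μ ∧ η x < (1/2 : ℝ)}

/-- `D_{1/2}`: points of the support where `η = 1/2`. -/
def Dhalf (μ : Measure E) (η : E → ℝ) : Set E := {x | x ∈ msupport μ ∧ η x = (1/2 : ℝ)}

/-- The partial neighborhood preserving robustness region `V_x^κ`, support version. -/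
def nbhdRegionKSupp (μ : Measure E) (η : E → ℝ) (κ : ℝ) (x : E) : Set E :=
  if x ∈ Dplus μ η then {x' | dist x x' < κ * infDist x' (Dminus μ η ∪ Dhalf μ η)}
  else if x ∈ Dminus μ η then {x' | dist x x' < κ * infDist x' (Dplus μ η ∪ Dhalf μ η)}
  else {x}

/-- The probability radius `r_p(x) = inf {r : μ(B(x,r)) ≥ p}`. -/
def probRadius (μ : Measure E) (p : ℝ) (x : E) : ℝ :=
  sInf {r : ℝ | ENNReal.ofReal p ≤ μ (closedBall x r)}

/-- `r_p^ε(x) = sup {r : μ(B(x,r)) − μ(B(x,r_p(x))) ≤ ε}`. -/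
def probRadiusEps (μ : Measure E) (p ε : ℝ) (x : E) : ℝ :=
  sSup {r : ℝ | (μ (closedBall x r)).toReal - (μ (closedBall x (probRadius μ p x))).toReal ≤ ε}

/-- `x` is `(p, Δ)`-covered: for all `x' ∈ U x` and all
`x'' ∈ B(x', r_p(x')) ∩ supp(μ)`, `η x'' > 1/2 + Δ`. -/
def Covered (μ : Measure E) (η : E → ℝ) (U : E → Set E) (p Δ : ℝ) (x : E) : Prop :=
  ∀ x' ∈ U x, ∀ x'' ∈ closedBall x' (probRadius μ p x') ∩ msupport μ, 1/2 + Δ < η x''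

end MetricDefs

/-- A weight function: for each sample of instances it produces nonnegative
weights summing to one, depending only on the instances. -/
structure WeightFn (E : Type*) where
  w : (n : ℕ) → (Fin n → E) → Fin n → E → ℝ
  nonneg : ∀ n xs i x, 0 ≤ w n xs i x
  le_one : ∀ n xs i x, w n xs i x ≤ 1
  sum_one : ∀ (n : ℕ) (xs : Fin n → E) (x : E), 0 < n → ∑ i, w n xs i x = 1

/-- The classifier learned by a weight function from the sample `S`:
`+1` iff `∑ i, w_i(x) y_i > 0`. -/
def WeightFn.classify {E : Type*} (W : WeightFn E) {n : ℕ} (S : Fin n → E × Bool) : E → Bool :=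
  fun x => if 0 < ∑ i, W.w n (fun j => (S j).1) i x * labelVal (S i).2 then true else false

/-- The splitting number of a family of weights on a fixed sample: the number of
distinct sets `{i : ρ(x, x_i) ≤ α, w_i(x) ≥ β}`. -/
def splitNumRaw {E : Type*} [MetricSpace E] {n : ℕ} (xs : Fin n → E) (w : Fin n → E → ℝ) : ℕ :=
  Set.ncard {T : Set (Fin n) | ∃ (x : E) (α β : ℝ), 0 ≤ α ∧ β ∈ Icc (0:ℝ) 1 ∧
    T = {i | dist x (xs i) ≤ α ∧ β ≤ w i x}}

/-- The splitting number `T(W, S)` of a weight function. -/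
def WeightFn.splitNum {E : Type*} [MetricSpace E] (W : WeightFn E) {n : ℕ}
    (xs : Fin n → E) : ℕ :=
  splitNumRaw xs (W.w n xs)

/-- Consistency with respect to accuracy: the accuracy of the learned classifier
converges in probability to the accuracy of the Bayes optimal classifier. -/
def ConsistentAcc {E : Type*} [MeasurableSpace E] (W : WeightFn E)
    (μ : Measure E) (η : E → ℝ) : Prop :=
  ∀ ε > (0:ℝ), ∀ δ > (0:ℝ), ∃ N : ℕ, ∀ n ≥ N,
    ENNReal.ofReal (1 - δ) ≤
      sampleD μ η n {S | accuracy μ η (bayes η) - ε ≤ accuracy μ η (W.classify S)}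

/-- Neighborhood consistency: for all `0 < ε, δ, κ < 1`, eventually with probability
at least `1 - δ` the astuteness w.r.t. `V^κ` is at least `A(g, D) - ε`. -/
def NbhdConsistent {E : Type*} [MetricSpace E] [MeasurableSpace E] (W : WeightFn E)
    (μ : Measure E) (η : E → ℝ) : Prop :=
  ∀ ε ∈ Ioo (0:ℝ) 1, ∀ δ ∈ Ioo (0:ℝ) 1, ∀ κ ∈ Ioo (0:ℝ) 1, ∃ N : ℕ, ∀ n ≥ N,
    ENNReal.ofReal (1 - δ) ≤
      sampleD μ η n {S | accuracy μ η (bayes η) - ε ≤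
        astuteness μ η (nbhdRegionK η κ) (W.classify S)}

/-- Condition 2 of the main theorem: vanishing expected supremal weight outside
the probability-radius balls. -/
def Cond2 {E : Type*} [MetricSpace E] [MeasurableSpace E] (W : WeightFn E)
    (μ : Measure E) (η : E → ℝ) : Prop :=
  ∀ p ∈ Ioo (0:ℝ) 1,
    Tendsto (fun n => ∫ S, (⨆ x : E, ∑ i, W.w n (fun j => (S j).1) i x *
      (if probRadius μ p x < dist x ((S i).1) then (1:ℝ) else 0)) ∂ sampleD μ η n)
      atTop (nhds 0)

/-- Condition 3 of the main theorem: `E[t_n · sup_x max_i w_i(x)] → 0`. -/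
def Cond3 {E : Type*} [MetricSpace E] [MeasurableSpace E] (W : WeightFn E)
    (μ : Measure E) (η : E → ℝ) (t : ℕ → ℕ) : Prop :=
  Tendsto (fun n => ∫ S, (t n : ℝ) *
    (⨆ x : E, ⨆ i, W.w n (fun j => (S j).1) i x) ∂ sampleD μ η n) atTop (nhds 0)

/-- Condition 4 of the main theorem: `E[log T(W,S) / t_n] → 0`. -/
def Cond4 {E : Type*} [MetricSpace E] [MeasurableSpace E] (W : WeightFn E)
    (μ : Measure E) (η : E → ℝ) (t : ℕ → ℕ) : Prop :=
  Tendsto (fun n => ∫ S, Real.log (W.splitNum (fun j => (S j).1)) / (t n : ℝ)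
    ∂ sampleD μ η n) atTop (nhds 0)

/-- `f` is a `k`-nearest neighbor classifier for the labelled sample `(xs, ys)`:
at every query point it takes a majority vote over some set of `k` nearest points. -/
def IsKNNClassifier {E : Type*} [MetricSpace E] {n : ℕ} (k : ℕ)
    (xs : Fin n → E) (ys : Fin n → Bool) (f : E → Bool) : Prop :=
  ∀ x : E, ∃ T : Finset (Fin n), T.card = min k n ∧
    (∀ i ∈ T, ∀ j ∉ T, dist x (xs i) ≤ dist x (xs j)) ∧
    (f x = true ↔ 0 < ∑ i ∈ T, labelVal (ys i))

/-- `W` is the weight function of the `k_n`-nearest neighbor classifier. -/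
def IsKNNWeightSeq {E : Type*} [MetricSpace E] (k : ℕ → ℕ) (W : WeightFn E) : Prop :=
  ∀ (n : ℕ) (xs : Fin n → E) (x : E), ∃ T : Finset (Fin n), T.card = min (k n) n ∧
    (∀ i ∈ T, ∀ j ∉ T, dist x (xs i) ≤ dist x (xs j)) ∧
    ∀ i, W.w n xs i x = if i ∈ T then ((min (k n) n : ℝ))⁻¹ else 0

/-- `w` is the weight family of the `k`-nearest neighbor rule on the sample `xs`
with ties in distance broken by smaller value of `z`. -/
def IsKNNTieWeight {E : Type*} [MetricSpace E] {n : ℕ} (k : ℕ) (xs : Fin n → E)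
    (z : Fin n → ℝ) (w : Fin n → E → ℝ) : Prop :=
  ∀ x : E, ∃ T : Finset (Fin n), T.card = min k n ∧
    (∀ i ∈ T, ∀ j ∉ T,
      dist x (xs i) < dist x (xs j) ∨ (dist x (xs i) = dist x (xs j) ∧ z i ≤ z j)) ∧
    ∀ i, w i x = if i ∈ T then ((min k n : ℝ))⁻¹ else 0

/-- The kernel weights `w_i(x) = K(ρ(x,x_i)/h) / ∑_j K(ρ(x,x_j)/h)`. -/
def kernelW (K : ℝ → ℝ) (h : ℝ) {E : Type*} [MetricSpace E] {n : ℕ}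
    (xs : Fin n → E) (i : Fin n) (x : E) : ℝ :=
  K (dist x (xs i) / h) / ∑ j, K (dist x (xs j) / h)

/-- The kernel classifier: `+1` iff `∑_i K(ρ(x,x_i)/h) y_i > 0`. -/
def kernelClassify (K : ℝ → ℝ) (h : ℝ) {E : Type*} [MetricSpace E] {n : ℕ}
    (S : Fin n → E × Bool) : E → Bool :=
  fun x => if 0 < ∑ i, K (dist x ((S i).1) / h) * labelVal (S i).2 then true else false

end

section Brackets

open MeasureTheory Set Filter Topology
open scoped ENNReal RealInnerProductSpace

variable {X E : Type*} [MeasurableSpace X] [NormedAddCommGroup E] [InnerProductSpace ℝ E]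

/-- The set `s` of functionals has a finite inner net: finitely many measurable sets of positive
mass such that each half-space `{z | 0 ≤ ⟪Φ z, f⟫}`, `f ∈ s`, of mass at least `p` contains one. -/
def HasInnerNet (μ : Measure X) (Φ : X → E) (p : ℝ≥0∞) (s : Set E) : Prop :=
  ∃ 𝒜 : Set (Set X), 𝒜.Finite ∧ (∀ A ∈ 𝒜, MeasurableSet A ∧ μ A ≠ 0) ∧
    ∀ f ∈ s, p ≤ μ {z | 0 ≤ ⟪Φ z, f⟫} → ∃ A ∈ 𝒜, A ⊆ {z | 0 ≤ ⟪Φ z, f⟫}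

namespace HasInnerNet

variable {μ : Measure X} {Φ : X → E} {p : ℝ≥0∞} {s t : Set E}

lemma mono (h : HasInnerNet μ Φ p t) (hst : s ⊆ t) : HasInnerNet μ Φ p s := by
  obtain ⟨𝒜, hfin, hpos, hnet⟩ := h
  exact ⟨𝒜, hfin, hpos, fun f hf => hnet f (hst hf)⟩

lemma union (hs : HasInnerNet μ Φ p s) (ht : HasInnerNet μ Φ p t) :
    HasInnerNet μ Φ p (s ∪ t) := by
  obtain ⟨𝒜, hfin, hpos, hnet⟩ := hs
  obtain ⟨ℬ, hfin', hpos', hnet'⟩ := ht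
  refine ⟨𝒜 ∪ ℬ, hfin.union hfin', fun A hA => hA.elim (hpos A) (hpos' A), ?_⟩
  rintro f (hf | hf) hp
  · obtain ⟨A, hA, h⟩ := hnet f hf hp
    exact ⟨A, Or.inl hA, h⟩
  · obtain ⟨A, hA, h⟩ := hnet' f hf hp
    exact ⟨A, Or.inr hA, h⟩

lemma empty : HasInnerNet μ Φ p ∅ :=
  ⟨∅, finite_empty, by simp, by simp⟩

lemma of_subset {A : Set X} (hA : MeasurableSet A) (hμ : μ A ≠ 0)
    (h : ∀ f ∈ s, A ⊆ {z | 0 ≤ ⟪Φ z, f⟫}) : HasInnerNet μ Φ p s :=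
  ⟨{A}, finite_singleton A, by simpa using ⟨hA, hμ⟩, fun f hf _ => ⟨A, rfl, h f hf⟩⟩

lemma zero (hp : p ≠ 0) : HasInnerNet μ Φ p {0} := by
  by_cases hμ : μ univ = 0
  · refine ⟨∅, finite_empty, by simp, fun f hf h => ?_⟩
    exact absurd (le_antisymm (h.trans ((measure_mono (subset_univ _)).trans hμ.le)) bot_le) hp
  · exact of_subset MeasurableSet.univ hμ (by simp)

end HasInnerNet

lemma abs_inner_sub_le (u f g : E) {δ : ℝ} (h : ‖f - g‖ ≤ δ) :
    |⟪u, f⟫ - ⟪u, g⟫| ≤ δ * ‖u‖ := by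
  rw [← inner_sub_right, mul_comm]
  exact (abs_real_inner_le_norm _ _).trans (mul_le_mul_of_nonneg_left h (norm_nonneg _))

variable [TopologicalSpace X] [OpensMeasurableSpace X]

/-- If the open half-space of `f₀` has positive mass, then so does a subset of it contained in
all nearby half-spaces. -/
lemma hasInnerNet_ball_of_pos {μ : Measure X} {Φ : X → E} (hΦ : Continuous Φ) (p : ℝ≥0∞)
    (f₀ : E) (h : μ {z | 0 < ⟪Φ z, f₀⟫} ≠ 0) :
    ∃ δ > 0, HasInnerNet μ Φ p (Metric.ball f₀ δ) := by
  have hU : {z | 0 < ⟪Φ z, f₀⟫} = ⋃ m : ℕ, {z | 1 / ((m : ℝ) + 1) * ‖Φ z‖ < ⟪Φ z, f₀⟫} := by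
    ext z
    simp only [mem_ofPred_eq, mem_iUnion]
    constructor
    · intro hz
      have hlim := (tendsto_one_div_add_atTop_nhds_zero_nat (𝕜 := ℝ)).mul_const ‖Φ z‖
      rw [zero_mul] at hlim
      exact (hlim.eventually_lt_const hz).exists
    · rintro ⟨m, hm⟩
      exact lt_of_le_of_lt (by positivity) hm
  rw [hU] at h
  obtain ⟨m, hm⟩ := exists_measure_pos_of_not_measure_iUnion_null h
  refine ⟨1 / ((m : ℝ) + 1), by positivity, HasInnerNet.of_subset
    (isOpen_lt (by fun_prop) (by fun_prop)).measurableSet hm.ne' fun f hf z hz => ?_⟩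
  rw [mem_ball_iff_norm] at hf
  have := (abs_le.1 (abs_inner_sub_le (Φ z) f f₀ hf.le)).1
  simp only [mem_ofPred_eq] at hz ⊢
  linarith

/-- If the open half-space of `f₀` is null, then inner nets near `f₀` come from inner nets for the
functionals orthogonal to `f₀` on the hyperplane `⟪Φ z, f₀⟫ = 0`. -/
lemma hasInnerNet_ball_of_null {μ : Measure X} [IsFiniteMeasure μ] {Φ : X → E}
    (hΦ : Continuous Φ) {p : ℝ≥0∞} (hp : p ≠ 0) (S : Submodule ℝ E) {f₀ : E} (hf₀ : f₀ ∈ S)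
    (hnorm : ‖f₀‖ = 1) (h : μ {z | 0 < ⟪Φ z, f₀⟫} = 0)
    (ih : HasInnerNet (μ.restrict {z | ⟪Φ z, f₀⟫ = 0}) Φ (p / 2) (S ⊓ (ℝ ∙ f₀)ᗮ : Submodule ℝ E)) :
    ∃ δ > 0, HasInnerNet μ Φ p (Metric.ball f₀ δ ∩ S) := by
  set H : Set X := {z | ⟪Φ z, f₀⟫ = 0} with hH
  have hHm : MeasurableSet H := (isClosed_eq (by fun_prop) (by fun_prop)).measurableSet
  let D : ℕ → Set X := fun m =>
    {z | ⟪Φ z, f₀⟫ < 0} ∩ {z | -(1 / ((m : ℝ) + 1) * ‖Φ z‖) ≤ ⟪Φ z, f₀⟫}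
  have hDm : ∀ m, MeasurableSet (D m) := fun m =>
    (isOpen_lt (by fun_prop) (by fun_prop)).measurableSet.inter
      (isClosed_le (by fun_prop) (by fun_prop)).measurableSet
  have hDanti : Antitone D := by
    intro a b hab z hz
    refine ⟨hz.1, ?_⟩
    have h1 : 1 / ((b : ℝ) + 1) * ‖Φ z‖ ≤ 1 / ((a : ℝ) + 1) * ‖Φ z‖ := by gcongr
    have h2 := hz.2
    simp only [mem_ofPred_eq] at h2 ⊢
    linarith
  have hDempty : ⋂ m, D m = ∅ := by
    refine eq_empty_of_forall_notMem fun z hz => ?_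
    rw [mem_iInter] at hz
    have hlim := ((tendsto_one_div_add_atTop_nhds_zero_nat (𝕜 := ℝ)).mul_const ‖Φ z‖).neg
    rw [zero_mul, neg_zero] at hlim
    exact absurd (le_of_tendsto' hlim fun m => (hz m).2) (not_le.2 (hz 0).1)
  have hlim : Tendsto (fun m => μ (D m)) atTop (𝓝 0) := by
    simpa [hDempty, Function.comp_def] using tendsto_measure_iInter_atTop (μ := μ)
      (fun m => (hDm m).nullMeasurableSet) hDanti ⟨0, measure_ne_top _ _⟩
  obtain ⟨m, hm⟩ := (hlim.eventually_lt_const (ENNReal.half_pos hp)).exists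
  obtain ⟨𝒜, hfin, hpos, hnet⟩ := ih
  refine ⟨1 / ((m : ℝ) + 1), by positivity, (fun A => A ∩ H) '' 𝒜, hfin.image _, ?_, ?_⟩
  · rintro _ ⟨A, hA, rfl⟩
    refine ⟨(hpos A hA).1.inter hHm, ?_⟩
    have := (hpos A hA).2
    rwa [Measure.restrict_apply (hpos A hA).1] at this
  rintro f ⟨hf, hfS⟩ hpf
  rw [mem_ball_iff_norm] at hf
  set g : E := f - ⟪f₀, f⟫ • f₀ with hg
  have hgS : g ∈ S ⊓ (ℝ ∙ f₀)ᗮ := by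
    refine ⟨S.sub_mem hfS (S.smul_mem _ hf₀), ?_⟩
    rw [SetLike.mem_coe, Submodule.mem_orthogonal_singleton_iff_inner_right, hg, inner_sub_right,
      real_inner_smul_right, real_inner_self_eq_norm_sq, hnorm]
    ring
  have hgf : ∀ z ∈ H, ⟪Φ z, g⟫ = ⟪Φ z, f⟫ := by
    intro z hz
    rw [hg, inner_sub_right, real_inner_smul_right, show ⟪Φ z, f₀⟫ = 0 from hz]
    ring
  have hsub : {z | 0 ≤ ⟪Φ z, f⟫} ⊆ {z | 0 < ⟪Φ z, f₀⟫} ∪ (D m ∪ {z | 0 ≤ ⟪Φ z, g⟫} ∩ H) := by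
    intro z hz
    have h1 := (abs_le.1 (abs_inner_sub_le (Φ z) f f₀ hf.le)).2
    simp only [mem_ofPred_eq] at hz
    rcases lt_trichotomy ⟪Φ z, f₀⟫ 0 with h0 | h0 | h0
    · refine Or.inr (Or.inl ⟨h0, ?_⟩)
      simp only [mem_ofPred_eq]
      linarith
    · exact Or.inr (Or.inr ⟨by simpa [hgf z h0] using hz, h0⟩)
    · exact Or.inl h0
  have hmass : p ≤ μ (D m) + μ ({z | 0 ≤ ⟪Φ z, g⟫} ∩ H) := by
    calc p ≤ _ := hpf
      _ ≤ _ := measure_mono hsub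
      _ ≤ _ := measure_union_le _ _
      _ = μ (D m ∪ {z | 0 ≤ ⟪Φ z, g⟫} ∩ H) := by rw [h, zero_add]
      _ ≤ _ := measure_union_le _ _
  have hgp : p / 2 ≤ μ.restrict H {z | 0 ≤ ⟪Φ z, g⟫} := by
    rw [Measure.restrict_apply (isClosed_le (by fun_prop) (by fun_prop)).measurableSet]
    by_contra! hlt
    have := hmass.trans_lt (ENNReal.add_lt_add hm hlt)
    rw [ENNReal.add_halves] at this
    exact lt_irrefl _ this
  obtain ⟨A, hA, hAg⟩ := hnet g hgS hgp
  refine ⟨A ∩ H, ⟨A, hA, rfl⟩, fun z hz => ?_⟩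
  have := hAg hz.1
  rwa [mem_ofPred_eq, hgf z hz.2] at this

lemma hasInnerNet_submodule [FiniteDimensional ℝ E] {Φ : X → E} (hΦ : Continuous Φ) (S : Submodule ℝ E)
    (μ : Measure X) [IsFiniteMeasure μ] {p : ℝ≥0∞} (hp : p ≠ 0) : HasInnerNet μ Φ p S := by
  induction hn : Module.finrank ℝ S using Nat.strong_induction_on generalizing S μ p with
  | _ n ih =>
  have hcompact : IsCompact (Metric.sphere (0 : E) 1 ∩ S) :=
    (isCompact_sphere _ _).inter_right S.closed_of_finiteDimensional
  have hsphere : HasInnerNet μ Φ p (Metric.sphere (0 : E) 1 ∩ S) := by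
    refine hcompact.induction_on HasInnerNet.empty (fun s t hst ht => ht.mono hst)
      (fun s t hs ht => hs.union ht) ?_
    rintro f₀ ⟨hnorm, hf₀⟩
    rw [mem_sphere_zero_iff_norm] at hnorm
    have hlt : S ⊓ (ℝ ∙ f₀)ᗮ < S := by
      refine lt_of_le_of_ne inf_le_left fun heq => ?_
      have : f₀ ∈ S ⊓ (ℝ ∙ f₀)ᗮ := by rw [heq]; exact hf₀
      have h0 := Submodule.mem_orthogonal_singleton_iff_inner_right.1 this.2
      rw [real_inner_self_eq_norm_sq, hnorm] at h0
      norm_num at h0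
    have hnet : ∃ δ > 0, HasInnerNet μ Φ p (Metric.ball f₀ δ ∩ S) := by
      by_cases h : μ {z | 0 < ⟪Φ z, f₀⟫} = 0
      · exact hasInnerNet_ball_of_null hΦ hp S hf₀ hnorm h
          (ih _ (hn ▸ Submodule.finrank_lt_finrank_of_lt hlt) _ _ (ENNReal.half_pos hp).ne' rfl)
      · obtain ⟨δ, hδ, hb⟩ := hasInnerNet_ball_of_pos hΦ p f₀ h
        exact ⟨δ, hδ, hb.mono inter_subset_left⟩
    obtain ⟨δ, hδ, hb⟩ := hnet
    refine ⟨Metric.ball f₀ δ ∩ (Metric.sphere (0 : E) 1 ∩ S),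
      inter_mem (mem_nhdsWithin_of_mem_nhds (Metric.ball_mem_nhds _ hδ)) self_mem_nhdsWithin,
      hb.mono (inter_subset_inter_right _ inter_subset_right)⟩
  obtain ⟨𝒜, hfin, hpos, hnet⟩ := hsphere.union (HasInnerNet.zero (μ := μ) (Φ := Φ) hp)
  refine ⟨𝒜, hfin, hpos, fun f hf hpf => ?_⟩
  rcases eq_or_ne f 0 with rfl | hf0
  · exact hnet 0 (Or.inr rfl) hpf
  have hset : {z | 0 ≤ ⟪Φ z, ‖f‖⁻¹ • f⟫} = {z | 0 ≤ ⟪Φ z, f⟫} := by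
    ext z
    have : 0 < ‖f‖⁻¹ := by positivity
    simp only [mem_ofPred_eq, real_inner_smul_right, mul_nonneg_iff_of_pos_left this]
  rw [← hset] at hpf ⊢
  refine hnet _ (Or.inl ⟨?_, S.smul_mem _ hf⟩) hpf
  rw [mem_sphere_zero_iff_norm, norm_smul, norm_inv, norm_norm, inv_mul_cancel₀ (by simpa)]

end Brackets

section Balls

open MeasureTheory Metric Set Filter Topology
open scoped ENNReal RealInnerProductSpace

/-- Finitely many sets of positive mass suffice to find one inside every closed ball of mass at
least `p`. -/
lemma exists_finite_inner_net_closedBall {V : Type*} [NormedAddCommGroup V]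
    [InnerProductSpace ℝ V] [FiniteDimensional ℝ V] [MeasurableSpace V] [BorelSpace V]
    (μ : Measure V) [IsFiniteMeasure μ] {p : ℝ≥0∞} (hp : p ≠ 0) :
    ∃ 𝒜 : Set (Set V), 𝒜.Finite ∧ (∀ A ∈ 𝒜, MeasurableSet A ∧ μ A ≠ 0) ∧
      ∀ (x : V) (r : ℝ), 0 ≤ r → p ≤ μ (closedBall x r) → ∃ A ∈ 𝒜, A ⊆ closedBall x r := by
  let Φ : V → WithLp 2 (V × WithLp 2 (ℝ × ℝ)) := fun z =>
    WithLp.toLp 2 (z, WithLp.toLp 2 (1, ‖z‖ ^ 2))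
  have hΦ : Continuous Φ := by fun_prop
  obtain ⟨𝒜, hfin, hpos, hnet⟩ := hasInnerNet_submodule hΦ ⊤ μ hp
  refine ⟨𝒜, hfin, hpos, fun x r hr hball => ?_⟩
  have hset : {z | 0 ≤ ⟪Φ z, WithLp.toLp 2 ((2 : ℝ) • x, WithLp.toLp 2 (r ^ 2 - ‖x‖ ^ 2, (-1 : ℝ)))⟫}
      = closedBall x r := by
    ext z
    rw [mem_closedBall_iff_norm, ← sq_le_sq₀ (norm_nonneg _) hr, norm_sub_sq_real]
    simp only [Φ, mem_ofPred_eq, WithLp.prod_inner_apply, real_inner_smul_right]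
    simp
    constructor <;> intro h <;> linarith
  rw [← hset] at hball ⊢
  exact hnet _ trivial hball

variable {E : Type*} [MetricSpace E] [MeasurableSpace E]

lemma probRadius_nonneg (μ : Measure E) {p : ℝ} (hp : 0 < p) (x : E) :
    0 ≤ probRadius μ p x := by
  refine Real.sInf_nonneg fun r hr => ?_
  by_contra! h
  rw [mem_ofPred_eq, closedBall_eq_empty.2 h, measure_empty] at hr
  exact (ENNReal.ofReal_pos.2 hp).not_ge hr

lemma le_measure_closedBall_probRadius [OpensMeasurableSpace E] (μ : Measure E) [IsProbabilityMeasure μ] {p : ℝ}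
    (hp : p < 1) (x : E) : ENNReal.ofReal p ≤ μ (closedBall x (probRadius μ p x)) := by
  have hne : {r : ℝ | ENNReal.ofReal p ≤ μ (closedBall x r)}.Nonempty := by
    have hlim : Tendsto (fun n : ℕ => μ (closedBall x n)) atTop (𝓝 1) := by
      have := tendsto_measure_iUnion_atTop (μ := μ) (s := fun n : ℕ => closedBall x (n : ℝ))
        (fun a b hab => closedBall_subset_closedBall (by exact_mod_cast hab))
      rwa [iUnion_closedBall_nat, measure_univ] at this
    obtain ⟨n, hn⟩ := (hlim.eventually_const_lt (ENNReal.ofReal_lt_one.2 hp)).exists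
    exact ⟨n, hn.le⟩
  have hInter : closedBall x (probRadius μ p x) =
      ⋂ m : ℕ, closedBall x (probRadius μ p x + 1 / ((m : ℝ) + 1)) := by
    ext z
    simp only [mem_closedBall, mem_iInter]
    refine ⟨fun h m => h.trans (le_add_of_nonneg_right (by positivity)), fun h => ?_⟩
    have hlim := (tendsto_one_div_add_atTop_nhds_zero_nat (𝕜 := ℝ)).const_add (probRadius μ p x)
    rw [add_zero] at hlim
    exact ge_of_tendsto' hlim h
  rw [hInter]
  refine ge_of_tendsto' (tendsto_measure_iInter_atTop
    (fun m => isClosed_closedBall.measurableSet.nullMeasurableSet) ?_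
    ⟨0, measure_ne_top _ _⟩) fun m => ?_
  · intro a b hab
    refine closedBall_subset_closedBall ?_
    gcongr
  · obtain ⟨r, hr, hlt⟩ := exists_lt_of_csInf_lt hne
      (lt_add_of_pos_right (probRadius μ p x) (by positivity : (0 : ℝ) < 1 / ((m : ℝ) + 1)))
    exact le_trans hr (measure_mono (closedBall_subset_closedBall hlt.le))

end Balls

section Sampling

open MeasureTheory Set Filter Topology
open scoped ENNReal Classical

variable {E : Type*}

/-- The factor contributed by one sample point to the moment generating function, at `-1`, of the
number of sample points in `A`. -/
noncomputable def expNegIndicator (A : Set E) (q : E × Bool) : ℝ :=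
  if q.1 ∈ A then Real.exp (-1) else 1

lemma expNegIndicator_pos (A : Set E) (q : E × Bool) : 0 < expNegIndicator A q := by
  unfold expNegIndicator
  split_ifs <;> positivity

lemma expNegIndicator_eq (A : Set E) :
    expNegIndicator A = fun q : E × Bool =>
      1 - (Prod.fst ⁻¹' A).indicator (fun _ => 1 - Real.exp (-1)) q := by
  ext q
  by_cases h : q.1 ∈ A <;> simp [expNegIndicator, h]

lemma exp_neg_le_prod_expNegIndicator {n k : ℕ} {A : Set E} (S : Fin n → E × Bool)
    {T : Finset (Fin n)} (hT : T.card ≤ k) (hA : ∀ i, (S i).1 ∈ A → i ∈ T) :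
    Real.exp (-k) ≤ ∏ i, expNegIndicator A (S i) := by
  have hprod : ∏ i, expNegIndicator A (S i)
      = Real.exp (-1) ^ (Finset.univ.filter fun i => (S i).1 ∈ A).card := by
    simp [expNegIndicator, Finset.prod_ite]
  have hcard : (Finset.univ.filter fun i => (S i).1 ∈ A).card ≤ k :=
    (Finset.card_le_card fun i hi => hA i (Finset.mem_filter.1 hi).2).trans hT
  rw [hprod, ← Real.exp_nat_mul, Real.exp_le_exp]
  have : ((Finset.univ.filter fun i => (S i).1 ∈ A).card : ℝ) ≤ k := by exact_mod_cast hcard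
  linarith

lemma tendsto_exp_mul_pow_zero {k : ℕ → ℕ}
    (hk : Tendsto (fun n : ℕ => (k n : ℝ) / n) atTop (𝓝 0)) {c : ℝ} (hc0 : 0 < c) (hc1 : c < 1) :
    Tendsto (fun n : ℕ => Real.exp (k n) * c ^ n) atTop (𝓝 0) := by
  have hlim : Tendsto (fun n : ℕ => (n : ℝ) * ((k n : ℝ) / n + Real.log c)) atTop atBot := by
    refine tendsto_natCast_atTop_atTop.atTop_mul_neg (C := Real.log c) (Real.log_neg hc0 hc1) ?_
    simpa using hk.add_const (Real.log c)
  refine (Real.tendsto_exp_atBot.comp hlim).congr' ?_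
  filter_upwards [eventually_gt_atTop 0] with n hn
  have hn' : (n : ℝ) ≠ 0 := by positivity
  rw [Function.comp_apply, mul_add, mul_div_cancel₀ _ hn', Real.exp_add, Real.exp_nat_mul,
    Real.exp_log hc0]

variable [MeasurableSpace E]

lemma jointD_fst_preimage (μ : Measure E) {η : E → ℝ} (hη : Measurable η)
    (hη01 : ∀ x, η x ∈ Icc (0 : ℝ) 1) {A : Set E} (hA : MeasurableSet A) :
    jointD μ η (Prod.fst ⁻¹' A) = μ A := by
  have hmeas : Measurable fun x => ENNReal.ofReal (η x) • Measure.dirac (x, true) +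
      ENNReal.ofReal (1 - η x) • Measure.dirac (x, false) := by
    refine Measure.measurable_of_measurable_coe _ fun s hs => ?_
    have h : ∀ b : Bool, Measurable fun x : E => s.indicator (1 : E × Bool → ℝ≥0∞) (x, b) :=
      fun b => (measurable_one.indicator hs).comp (measurable_id.prodMk measurable_const)
    simp only [Measure.coe_add, Measure.coe_smul, Pi.add_apply, Pi.smul_apply, smul_eq_mul,
      Measure.dirac_apply' _ hs]
    exact (hη.ennreal_ofReal.mul (h true)).add
      ((measurable_const.sub hη).ennreal_ofReal.mul (h false))
  have hA' : MeasurableSet (Prod.fst ⁻¹' A : Set (E × Bool)) := measurable_fst hA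
  rw [jointD, Measure.bind_apply hA' hmeas.aemeasurable, ← lintegral_indicator_one hA]
  refine lintegral_congr fun x => ?_
  simp only [Measure.coe_add, Measure.coe_smul, Pi.add_apply, Pi.smul_apply, smul_eq_mul,
    Measure.dirac_apply' _ hA']
  by_cases hx : x ∈ A
  · have : ENNReal.ofReal (η x) + ENNReal.ofReal (1 - η x) = 1 := by
      rw [← ENNReal.ofReal_add (hη01 x).1 (sub_nonneg.2 (hη01 x).2)]
      simp
    simpa [hx] using this
  · simp [hx]

lemma isProbabilityMeasure_jointD (μ : Measure E) [IsProbabilityMeasure μ] {η : E → ℝ}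
    (hη : Measurable η) (hη01 : ∀ x, η x ∈ Icc (0 : ℝ) 1) :
    IsProbabilityMeasure (jointD μ η) :=
  ⟨by simpa using jointD_fst_preimage μ hη hη01 MeasurableSet.univ⟩

lemma integrable_expNegIndicator (ν : Measure (E × Bool)) [IsFiniteMeasure ν] {A : Set E}
    (hA : MeasurableSet A) : Integrable (expNegIndicator A) ν := by
  rw [expNegIndicator_eq]
  exact (integrable_const _).sub ((integrable_const _).indicator (measurable_fst hA))

lemma integral_expNegIndicator (ν : Measure (E × Bool)) [IsProbabilityMeasure ν] {A : Set E}
    (hA : MeasurableSet A) : ∫ q, expNegIndicator A q ∂ν =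
      1 - ν.real (Prod.fst ⁻¹' A) * (1 - Real.exp (-1)) := by
  rw [expNegIndicator_eq, integral_sub (integrable_const _)
    ((integrable_const _).indicator (measurable_fst hA)),
    integral_indicator_const _ (measurable_fst hA)]
  simp

lemma integral_prod_expNegIndicator (ν : Measure (E × Bool)) [IsProbabilityMeasure ν]
    (A : Set E) (n : ℕ) :
    ∫ S, ∏ i, expNegIndicator A (S i) ∂(Measure.pi fun _ : Fin n => ν) =
      (∫ q, expNegIndicator A q ∂ν) ^ n := by
  rw [integral_fintype_prod_eq_pow (𝕜 := ℝ) (ι := Fin n) (expNegIndicator A), Fintype.card_fin]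

end Sampling

section NearestNeighbors

open MeasureTheory Metric Set Filter Topology
open scoped ENNReal Classical

lemma IsKNNWeightSeq.exists_card_le {E : Type*} [MetricSpace E] {k : ℕ → ℕ} {W : WeightFn E}
    (hW : IsKNNWeightSeq k W) {n : ℕ} (xs : Fin n → E) (x : E) {i : Fin n} {r : ℝ}
    (hi : W.w n xs i x ≠ 0) (hr : r < dist x (xs i)) :
    ∃ T : Finset (Fin n), T.card ≤ k n ∧ ∀ j, xs j ∈ closedBall x r → j ∈ T := by
  obtain ⟨T, hcard, hnear, hw⟩ := hW n xs x
  refine ⟨T, hcard.trans_le (min_le_left _ _), fun j hj => ?_⟩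
  have hiT : i ∈ T := by
    by_contra h
    exact hi (by rw [hw, if_neg h])
  by_contra hjT
  rw [mem_closedBall, dist_comm] at hj
  exact absurd (hnear i hiT j hjT) (not_le.2 (hj.trans_lt hr))

lemma WeightFn.sum_mul_ite_le_one {E : Type*} (W : WeightFn E) {n : ℕ} (xs : Fin n → E) (x : E)
    (P : Fin n → Prop) : ∑ i, W.w n xs i x * (if P i then (1 : ℝ) else 0) ≤ 1 := by
  rcases Nat.eq_zero_or_pos n with rfl | hn
  · simp
  · refine (Finset.sum_le_sum fun i _ => ?_).trans_eq (W.sum_one n xs x hn)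
    split_ifs
    · rw [mul_one]
    · simpa using W.nonneg n xs i x

end NearestNeighbors

section Statements

open MeasureTheory Metric Set Filter Topology
open scoped ENNReal Classical

/-- for the `k_n`-NN weight function with `k_n/n → 0`, the expected
supremal weight outside the probability-radius balls vanishes. -/
theorem stmt14 {d : ℕ} (k : ℕ → ℕ) (hkpos : ∀ n, 0 < k n)
    (hk : Tendsto (fun n : ℕ => (k n : ℝ) / n) atTop (nhds 0))
    (W : WeightFn (Eucl d)) (hW : IsKNNWeightSeq k W)
    (μ : Measure (Eucl d)) [IsProbabilityMeasure μ] (η : Eucl d → ℝ)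
    (hηm : Measurable η) (hη01 : ∀ x, η x ∈ Icc (0:ℝ) 1)
    (p : ℝ) (hp : p ∈ Ioo (0:ℝ) 1) :
    Tendsto (fun n => ∫ S, (⨆ x : Eucl d, ∑ i, W.w n (fun j => (S j).1) i x *
      (if probRadius μ p x < dist x ((S i).1) then (1:ℝ) else 0)) ∂ sampleD μ η n)
      atTop (nhds 0) := by
  have := isProbabilityMeasure_jointD μ hηm hη01
  obtain ⟨𝒜, hfin, hpos, hnet⟩ :=
    exists_finite_inner_net_closedBall μ (ENNReal.ofReal_pos.2 hp.1).ne'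
  let c : Set (Eucl d) → ℝ := fun A => ∫ q, expNegIndicator A q ∂jointD μ η
  have hc : ∀ A ∈ 𝒜, 0 < c A ∧ c A < 1 := by
    intro A hA
    have hm := (hpos A hA).1
    have hq : (jointD μ η).real (Prod.fst ⁻¹' A) = μ.real A := by
      rw [measureReal_def, jointD_fst_preimage μ hηm hη01 hm, measureReal_def]
    have hq0 : 0 < μ.real A := ENNReal.toReal_pos (hpos A hA).2 (measure_ne_top _ _)
    have hq1 : μ.real A ≤ 1 := measureReal_le_one
    have he0 : 0 < Real.exp (-1) := Real.exp_pos _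
    have he1 : Real.exp (-1) < 1 := Real.exp_lt_one_iff.2 (by norm_num)
    simp only [c, integral_expNegIndicator _ hm, hq]
    constructor <;> nlinarith
  have hbound : ∀ n, ∫ S, (⨆ x : Eucl d, ∑ i, W.w n (fun j => (S j).1) i x *
      (if probRadius μ p x < dist x ((S i).1) then (1:ℝ) else 0)) ∂ sampleD μ η n ≤
      ∑ A ∈ hfin.toFinset, Real.exp (k n) * c A ^ n := by
    intro n
    have hint : ∀ A ∈ hfin.toFinset, Integrable (fun S : Fin n → Eucl d × Bool =>
        Real.exp (k n) * ∏ i, expNegIndicator A (S i)) (sampleD μ η n) := fun A hA =>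
      (Integrable.fintype_prod (𝕜 := ℝ) fun _ => integrable_expNegIndicator (jointD μ η)
        (hpos A (hfin.mem_toFinset.1 hA)).1).const_mul _
    have hval : ∑ A ∈ hfin.toFinset, Real.exp (k n) * c A ^ n =
        ∫ S, ∑ A ∈ hfin.toFinset, Real.exp (k n) * ∏ i, expNegIndicator A (S i)
          ∂sampleD μ η n := by
      rw [integral_finsetSum _ hint]
      refine Finset.sum_congr rfl fun A _ => ?_
      rw [integral_const_mul, sampleD, integral_prod_expNegIndicator]
    rw [hval]
    refine integral_mono_of_nonneg (Eventually.of_forall fun S => ?_)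
      (integrable_finsetSum _ hint) (Eventually.of_forall fun S => ?_)
    · refine Real.iSup_nonneg fun x => Finset.sum_nonneg fun i _ =>
        mul_nonneg (W.nonneg _ _ _ _) ?_
      split_ifs <;> norm_num
    have hterm : ∀ A ∈ hfin.toFinset,
        0 ≤ Real.exp (k n) * ∏ i, expNegIndicator A (S i) := fun A _ =>
      mul_nonneg (Real.exp_pos _).le
        (Finset.prod_nonneg fun i _ => (expNegIndicator_pos A (S i)).le)
    refine ciSup_le fun x => ?_
    by_cases hx : ∃ i, W.w n (fun j => (S j).1) i x ≠ 0 ∧ probRadius μ p x < dist x (S i).1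
    · obtain ⟨i, hi, hr⟩ := hx
      obtain ⟨T, hT, hball⟩ := hW.exists_card_le (fun j => (S j).1) x hi hr
      obtain ⟨A, hA, hAb⟩ := hnet x _ (probRadius_nonneg μ hp.1 x)
        (le_measure_closedBall_probRadius μ hp.2 x)
      have hle := exp_neg_le_prod_expNegIndicator S hT fun j hj => hball j (hAb hj)
      refine (W.sum_mul_ite_le_one _ x _).trans (le_trans ?_
        (Finset.single_le_sum hterm (hfin.mem_toFinset.2 hA)))
      calc (1 : ℝ) = Real.exp (k n) * Real.exp (-k n) := by rw [← Real.exp_add]; simp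
        _ ≤ _ := mul_le_mul_of_nonneg_left hle (Real.exp_pos _).le
    · push Not at hx
      refine le_trans (Finset.sum_eq_zero fun i _ => ?_).le (Finset.sum_nonneg hterm)
      by_cases hi : W.w n (fun j => (S j).1) i x = 0
      · rw [hi, zero_mul]
      · rw [if_neg (not_lt.2 (hx i hi)), mul_zero]
  have hlim : Tendsto (fun n => ∑ A ∈ hfin.toFinset, Real.exp (k n) * c A ^ n) atTop (𝓝 0) := by
    rw [← Finset.sum_const_zero (s := hfin.toFinset)]
    refine tendsto_finsetSum _ fun A hA => ?_
    obtain ⟨h0, h1⟩ := hc A (hfin.mem_toFinset.1 hA)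
    exact tendsto_exp_mul_pow_zero hk h0 h1
  refine squeeze_zero (fun n => integral_nonneg fun S => ?_) hbound hlim
  refine Real.iSup_nonneg fun x => Finset.sum_nonneg fun i _ => mul_nonneg (W.nonneg _ _ _ _) ?_
  split_ifs <;> norm_num

end Statements
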